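/- Let d ∈ ℕ, let b₁,…,b_d ∈ C³([0,1]^d,ℝ) satisfy for all i ∈ {1,…,d} and all x = (x₁,…,x_d) ∈ [0,1]^d with x_i ∈ {0,1} that (−1)^{x_i} b_i(x) ≥ 0, and let y be the associated flow. Assume additionally (as follows from standard ODE theory) that for every t ∈ [0,∞) the map x ↦ y(t,x) is twice continuously differentiable on [0,1]^d with all first and second partial derivatives jointly continuous in (t,x). Then for every f ∈ C²([0,1]^d,ℝ) and every t ∈ [0,∞) it holds that T¹_t f ∈ C²([0,1]^d,ℝ) and ‖T¹_t f‖_{C²} ≤ e^{4 λ₂ t} ‖f‖_{C²}. -/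

import Mathlib

open MeasureTheory Filter

noncomputable section

/-- The unit cube `[0,1]^d` in `ℝ^d`. -/
def cube (d : ℕ) : Set (Fin d → ℝ) := Set.univ.pi fun _ => Set.Icc (0:ℝ) 1

/-- Partial derivative in coordinate `i` (within `[0,1]`, i.e. one-sided at the boundary). -/
def pd (d : ℕ) (i : Fin d) (g : (Fin d → ℝ) → ℝ) : (Fin d → ℝ) → ℝ :=
  fun x => derivWithin (fun t => g (Function.update x i t)) (Set.Icc (0:ℝ) 1) (x i)

/-- Iterated partial derivative `∂^α` (coordinates applied in a fixed order). -/
def mderiv (d : ℕ) (α : Fin d → ℕ) (f : (Fin d → ℝ) → ℝ) : (Fin d → ℝ) → ℝ :=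
  List.foldr (fun i g => (pd d i)^[α i] g) f (List.finRange d)

/-- `f ∈ C^m([0,1]^d, ℝ)`: all partial derivatives of order `0` through `m` exist
(one-sidedly at the boundary) and are continuous on the cube. -/
def MemCm (d : ℕ) : ℕ → ((Fin d → ℝ) → ℝ) → Prop
  | 0, f => ContinuousOn f (cube d)
  | m + 1, f => ContinuousOn f (cube d) ∧ ∀ i : Fin d,
      (∀ x ∈ cube d, DifferentiableWithinAt ℝ (fun t => f (Function.update x i t))
        (Set.Icc (0:ℝ) 1) (x i)) ∧
      MemCm d m (pd d i f)

/-- Sup norm over the cube: `‖g‖_∞ = sup_{x ∈ [0,1]^d} |g(x)|`. -/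
def supCube (d : ℕ) (g : (Fin d → ℝ) → ℝ) : ℝ := ⨆ x : cube d, |g x.1|

/-- The `C^m`-norm: `max_{|α| ≤ m} sup_{x ∈ [0,1]^d} |∂^α f(x)|`. -/
def CmNorm (d m : ℕ) (f : (Fin d → ℝ) → ℝ) : ℝ :=
  ⨆ α : {α : Fin d → ℕ // (∑ i, α i) ≤ m}, supCube d (mderiv d α.1 f)

/-- `λ_m := max_{0 < |α| ≤ m} ∑_i ‖∂^α b_i‖_∞`. -/
def lamNorm (d m : ℕ) (b : Fin d → (Fin d → ℝ) → ℝ) : ℝ :=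
  ⨆ α : {α : Fin d → ℕ // 0 < (∑ i, α i) ∧ (∑ i, α i) ≤ m},
    ∑ i, supCube d (mderiv d α.1 (b i))

theorem cube_nonempty (d : ℕ) : (cube d).Nonempty :=
  ⟨fun _ => 0, fun _ _ => by simp⟩

theorem isCompact_cube (d : ℕ) : IsCompact (cube d) :=
  isCompact_univ_pi fun _ => isCompact_Icc

theorem uniqueDiffOn_cube (d : ℕ) : UniqueDiffOn ℝ (cube d) :=
  UniqueDiffOn.univ_pi fun _ => uniqueDiffOn_Icc zero_lt_one

theorem closure_pi_Ioo (d : ℕ) :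
    closure (Set.univ.pi fun _ : Fin d => Set.Ioo (0:ℝ) 1) = cube d := by
  rw [closure_pi_set]
  simp [cube, closure_Ioo]

theorem cube_subset_closure_interior (d : ℕ) : cube d ⊆ closure (interior (cube d)) := by
  rw [← closure_pi_Ioo]
  refine closure_mono (interior_maximal ?_ (isOpen_set_pi Set.finite_univ fun _ _ => isOpen_Ioo))
  rw [closure_pi_Ioo]
  exact Set.pi_mono fun _ _ => Set.Ioo_subset_Icc_self

theorem update_mem_cube {d : ℕ} {x : Fin d → ℝ} (hx : x ∈ cube d) (i : Fin d) {τ : ℝ}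
    (hτ : τ ∈ Set.Icc (0:ℝ) 1) : Function.update x i τ ∈ cube d := by
  intro j _
  by_cases h : j = i
  · subst h; simpa using hτ
  · simpa [Function.update_of_ne h] using hx j trivial

/-- `f` has partial derivative `f'` in coordinate `i` at the point `x` of the cube. -/
def HasPD (d : ℕ) (i : Fin d) (f : (Fin d → ℝ) → ℝ) (f' : ℝ) (x : Fin d → ℝ) : Prop :=
  HasDerivWithinAt (fun t => f (Function.update x i t)) f' (Set.Icc (0:ℝ) 1) (x i)

section PartialDerivatives

variable {d : ℕ} {f g : (Fin d → ℝ) → ℝ} {x : Fin d → ℝ}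

theorem HasPD.pd_eq {i : Fin d} {f' : ℝ} (h : HasPD d i f f' x) (hx : x ∈ cube d) :
    pd d i f x = f' :=
  HasDerivWithinAt.derivWithin h (uniqueDiffOn_Icc zero_lt_one _ (hx i trivial))

theorem HasPD.congr {i : Fin d} {f' : ℝ} (h : HasPD d i f f' x) (hx : x ∈ cube d)
    (hfg : Set.EqOn g f (cube d)) : HasPD d i g f' x :=
  HasDerivWithinAt.congr h (fun _ ht => hfg (update_mem_cube hx i ht))
    (hfg (update_mem_cube hx i (hx i trivial)))

theorem pd_congr (i : Fin d) (hfg : Set.EqOn g f (cube d)) :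
    Set.EqOn (pd d i g) (pd d i f) (cube d) := fun _ hx =>
  derivWithin_congr (fun _ ht => hfg (update_mem_cube hx i ht))
    (hfg (update_mem_cube hx i (hx i trivial)))

theorem MemCm.congr {m : ℕ} (hf : MemCm d m f) (hfg : Set.EqOn g f (cube d)) : MemCm d m g := by
  induction m generalizing f g with
  | zero => exact ContinuousOn.congr hf hfg
  | succ m ih =>
    refine ⟨hf.1.congr hfg, fun i => ⟨fun x hx => ?_, ih (hf.2 i).2 (pd_congr i hfg)⟩⟩
    exact ((hf.2 i).1 x hx).congr (fun _ ht => hfg (update_mem_cube hx i ht))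
      (hfg (update_mem_cube hx i (hx i trivial)))

theorem MemCm.continuousOn {m : ℕ} (hf : MemCm d m f) : ContinuousOn f (cube d) := by
  cases m with
  | zero => exact hf
  | succ m => exact hf.1

theorem MemCm.pd {m : ℕ} (hf : MemCm d (m + 1) f) (i : Fin d) : MemCm d m (pd d i f) :=
  (hf.2 i).2

theorem MemCm.of_succ {m : ℕ} (hf : MemCm d (m + 1) f) : MemCm d m f := by
  induction m generalizing f with
  | zero => exact hf.continuousOn
  | succ m ih => exact ⟨hf.1, fun i => ⟨(hf.2 i).1, ih (hf.2 i).2⟩⟩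

theorem MemCm.hasPD {m : ℕ} (hf : MemCm d (m + 1) f) (i : Fin d) (hx : x ∈ cube d) :
    HasPD d i f (_root_.pd d i f x) x :=
  ((hf.2 i).1 x hx).hasDerivWithinAt

/-- The candidate for the total derivative, assembled from the partial derivatives. -/
def pdSum (d : ℕ) (f : (Fin d → ℝ) → ℝ) (x : Fin d → ℝ) : (Fin d → ℝ) →L[ℝ] ℝ :=
  ∑ i, pd d i f x • ContinuousLinearMap.proj (R := ℝ) (φ := fun _ : Fin d => ℝ) i

theorem pdSum_apply (f : (Fin d → ℝ) → ℝ) (x v : Fin d → ℝ) :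
    pdSum d f x v = ∑ i, pd d i f x * v i := by
  simp [pdSum]

theorem abs_piecewise_sub_le {ε δ : ℝ}
    (hdiff : ∀ i, ∀ z ∈ cube d, HasPD d i f (pd d i f z) z)
    (hδ : ∀ i, ∀ w ∈ cube d, dist w x < δ → |pd d i f w - pd d i f x| ≤ ε)
    (hx : x ∈ cube d) {z : Fin d → ℝ} (hz : z ∈ cube d) (hzx : dist z x < δ)
    (s : Finset (Fin d)) :
    |f (s.piecewise z x) - f x - ∑ i ∈ s, pd d i f x * (z i - x i)|
      ≤ ∑ i ∈ s, ε * |z i - x i| := by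
  have hδ0 : 0 < δ := dist_nonneg.trans_lt hzx
  induction s using Finset.induction_on with
  | empty => simp
  | insert i s his ih =>
    set w := s.piecewise z x with hw
    have hwi : w i = x i := by simp [hw, his]
    have hwc : w ∈ cube d := by
      intro j _
      by_cases hj : j ∈ s
      · simpa [hw, hj] using hz j trivial
      · simpa [hw, hj] using hx j trivial
    rw [Finset.sum_insert his, Finset.sum_insert his, Finset.piecewise_insert, ← hw]
    have hsub : Set.uIcc (x i) (z i) ⊆ Set.Icc 0 1 :=
      Set.uIcc_subset_Icc (hx i trivial) (hz i trivial)
    have key := Convex.norm_image_sub_le_of_norm_hasDerivWithin_le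
      (f := fun τ => f (Function.update w i τ) - pd d i f x * τ)
      (f' := fun τ => pd d i f (Function.update w i τ) - pd d i f x * 1)
      (s := Set.uIcc (x i) (z i)) (x := x i) (y := z i) (C := ε)
      (fun τ hτ => by
        have h := hdiff i _ (update_mem_cube hwc i (hsub hτ))
        simp only [HasPD, Function.update_idem, Function.update_self] at h
        exact (h.mono hsub).sub ((hasDerivWithinAt_id _ _).const_mul _))
      (fun τ hτ => by
        rw [mul_one]
        refine hδ i _ (update_mem_cube hwc i (hsub hτ)) ?_
        rw [dist_pi_lt_iff hδ0]
        intro j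
        by_cases hj : j = i
        · subst hj
          rw [Function.update_self, Real.dist_eq]
          refine (Set.abs_sub_left_of_mem_uIcc hτ).trans_lt ?_
          exact (dist_le_pi_dist z x j).trans_lt hzx
        · rw [Function.update_of_ne hj]
          by_cases hjs : j ∈ s
          · simpa [hw, hjs] using (dist_le_pi_dist z x j).trans_lt hzx
          · simpa [hw, hjs] using hδ0)
      (convex_uIcc _ _) Set.left_mem_uIcc Set.right_mem_uIcc
    have hupd : Function.update w i (x i) = w := by rw [← hwi]; simp
    simp only [hupd, Real.norm_eq_abs] at key
    calc _ = |(f (Function.update w i (z i)) - pd d i f x * z i - (f w - pd d i f x * x i))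
            + (f w - f x - ∑ i ∈ s, pd d i f x * (z i - x i))| := by congr 1; ring
      _ ≤ _ := (abs_add_le _ _).trans (add_le_add key ih)

theorem MemCm.hasFDerivWithinAt {m : ℕ} (hf : MemCm d (m + 1) f) (hx : x ∈ cube d) :
    HasFDerivWithinAt f (pdSum d f x) (cube d) x := by
  rw [hasFDerivWithinAt_iff_isLittleO, Asymptotics.isLittleO_iff]
  intro c hc
  set ε := c / (d + 1) with hε
  have hε0 : 0 < ε := by positivity
  have hev : ∀ᶠ w in nhdsWithin x (cube d), ∀ i, |_root_.pd d i f w - _root_.pd d i f x| ≤ ε := by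
    rw [Filter.eventually_all]
    intro i
    have := Metric.tendsto_nhds.1 ((hf.pd i).continuousOn x hx) ε hε0
    filter_upwards [this] with w hw using hw.le
  obtain ⟨δ, hδ0, hδ⟩ := Metric.mem_nhdsWithin_iff.1 hev
  have hmem : Metric.ball x δ ∩ cube d ∈ nhdsWithin x (cube d) :=
    Filter.inter_mem (mem_nhdsWithin_of_mem_nhds (Metric.ball_mem_nhds x hδ0)) self_mem_nhdsWithin
  filter_upwards [hmem] with z hz
  have h := abs_piecewise_sub_le (fun i w hw => hf.hasPD i hw)
    (fun i w hw hwx => hδ ⟨hwx, hw⟩ i) hx hz.2 hz.1 Finset.univ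
  rw [Finset.piecewise_univ] at h
  rw [pdSum_apply, Real.norm_eq_abs]
  refine h.trans ?_
  calc ∑ i, ε * |z i - x i| ≤ ∑ _i : Fin d, ε * ‖z - x‖ := by
        gcongr with i
        exact norm_le_pi_norm (z - x) i
    _ = (d * ε) * ‖z - x‖ := by simp [mul_assoc]
    _ ≤ c * ‖z - x‖ := by
        gcongr
        rw [hε, mul_div_assoc', div_le_iff₀ (by positivity)]
        nlinarith

theorem MemCm.contDiffOn {m : ℕ} (hf : MemCm d m f) : ContDiffOn ℝ m f (cube d) := by
  induction m generalizing f with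
  | zero => exact contDiffOn_zero.2 hf
  | succ m ih =>
    push_cast
    rw [contDiffOn_succ_iff_hasFDerivWithinAt_of_uniqueDiffOn (uniqueDiffOn_cube d)]
    refine ⟨by simp, pdSum d f, ?_, fun x hx => hf.hasFDerivWithinAt hx⟩
    exact ContDiffOn.sum fun i _ => (ih (hf.pd i)).smul contDiffOn_const

theorem hasPD_of_hasFDerivWithinAt {f' : (Fin d → ℝ) →L[ℝ] ℝ} (i : Fin d)
    (h : HasFDerivWithinAt f f' (cube d) x) (hx : x ∈ cube d) :
    HasPD d i f (f' (Pi.single i 1)) x := by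
  have hu : HasDerivWithinAt (Function.update x i) (Pi.single i 1) (Set.Icc 0 1) (x i) :=
    (hasDerivAt_update x i (x i)).hasDerivWithinAt
  have h' : HasFDerivWithinAt f f' (cube d) (Function.update x i (x i)) := by simpa using h
  exact h'.comp_hasDerivWithinAt _ hu fun _ ht => update_mem_cube hx i ht

theorem pd_eq_fderivWithin (hf : DifferentiableWithinAt ℝ f (cube d) x) (i : Fin d)
    (hx : x ∈ cube d) : pd d i f x = fderivWithin ℝ f (cube d) x (Pi.single i 1) :=
  (hasPD_of_hasFDerivWithinAt i hf.hasFDerivWithinAt hx).pd_eq hx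

theorem memCm_of_contDiffOn {m : ℕ} (hf : ContDiffOn ℝ m f (cube d)) : MemCm d m f := by
  induction m generalizing f with
  | zero => exact hf.continuousOn
  | succ m ih =>
    have hdiff : DifferentiableOn ℝ f (cube d) := hf.differentiableOn (by simp)
    refine ⟨hf.continuousOn, fun i => ⟨fun x hx =>
      (hasPD_of_hasFDerivWithinAt i (hdiff x hx).hasFDerivWithinAt hx).differentiableWithinAt, ?_⟩⟩
    refine MemCm.congr (f := fun x => fderivWithin ℝ f (cube d) x (Pi.single i 1)) (ih ?_)
      fun x hx => pd_eq_fderivWithin (hdiff x hx) i hx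
    exact (hf.fderivWithin (uniqueDiffOn_cube d) (by simp)).clm_apply contDiffOn_const

theorem MemCm.pd_pd_eq_fderivWithin (hf : MemCm d 2 f) (i j : Fin d) (hx : x ∈ cube d) :
    _root_.pd d i (_root_.pd d j f) x =
      fderivWithin ℝ (fderivWithin ℝ f (cube d)) (cube d) x (Pi.single i 1) (Pi.single j 1) := by
  have hc : ContDiffOn ℝ 2 f (cube d) := hf.contDiffOn
  have hdiff : DifferentiableOn ℝ f (cube d) := hc.differentiableOn (by simp)
  have h1 : ContDiffOn ℝ 1 (fderivWithin ℝ f (cube d)) (cube d) :=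
    hc.fderivWithin (uniqueDiffOn_cube d) (by norm_num)
  have h2 := (h1.differentiableOn (by simp) x hx).hasFDerivWithinAt.clm_apply
    (hasFDerivWithinAt_const (Pi.single j (1:ℝ) : Fin d → ℝ) x (cube d))
  rw [pd_congr i (fun z hz => pd_eq_fderivWithin (hdiff z hz) j hz) hx,
    (hasPD_of_hasFDerivWithinAt i h2 hx).pd_eq hx]
  simp

theorem MemCm.pd_comm (hf : MemCm d 2 f) (i j : Fin d) (hx : x ∈ cube d) :
    _root_.pd d i (_root_.pd d j f) x = _root_.pd d j (_root_.pd d i f) x := by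
  have hc : ContDiffOn ℝ 2 f (cube d) := hf.contDiffOn
  rw [hf.pd_pd_eq_fderivWithin i j hx, hf.pd_pd_eq_fderivWithin j i hx]
  exact (hc x hx).isSymmSndFDerivWithinAt (by simp) (uniqueDiffOn_cube d)
    (cube_subset_closure_interior d hx) hx _ _

theorem MemCm.comp {m : ℕ} {Y : (Fin d → ℝ) → Fin d → ℝ} (hf : MemCm d m f)
    (hY : ∀ i, MemCm d m fun x => Y x i) (hmaps : Set.MapsTo Y (cube d) (cube d)) :
    MemCm d m fun x => f (Y x) :=
  memCm_of_contDiffOn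
    (hf.contDiffOn.comp (contDiffOn_pi.2 fun i => (hY i).contDiffOn) hmaps)

theorem hasPD_comp {m n : ℕ} {Y : (Fin d → ℝ) → Fin d → ℝ} (hf : MemCm d (m + 1) f)
    (hY : ∀ i, MemCm d (n + 1) fun x => Y x i) (hmaps : Set.MapsTo Y (cube d) (cube d))
    (j : Fin d) (hx : x ∈ cube d) :
    HasPD d j (fun x => f (Y x)) (∑ l, pd d l f (Y x) * pd d j (fun x => Y x l) x) x := by
  have h1 : HasFDerivWithinAt f (pdSum d f (Y x)) (cube d) (Y (Function.update x j (x j))) := by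
    simpa using hf.hasFDerivWithinAt (hmaps hx)
  have h2 : HasDerivWithinAt (fun t => Y (Function.update x j t))
      (fun l => pd d j (fun x => Y x l) x) (Set.Icc 0 1) (x j) :=
    hasDerivWithinAt_pi.2 fun l => (hY l).hasPD j hx
  have h3 := h1.comp_hasDerivWithinAt (x j) h2 fun t ht => hmaps (update_mem_cube hx j ht)
  rw [pdSum_apply] at h3
  exact h3

theorem hasPD_chain {Y : (Fin d → ℝ) → Fin d → ℝ} (hf : MemCm d 2 f)
    (hY : ∀ i, MemCm d 2 fun x => Y x i) (hmaps : Set.MapsTo Y (cube d) (cube d))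
    (j k : Fin d) (hx : x ∈ cube d) :
    HasPD d k (fun x => ∑ l, pd d l f (Y x) * pd d j (fun x => Y x l) x)
      (∑ l, ((∑ m, pd d m (pd d l f) (Y x) * pd d k (fun x => Y x m) x)
          * pd d j (fun x => Y x l) x
        + pd d l f (Y x) * pd d k (pd d j (fun x => Y x l)) x)) x := by
  refine HasDerivWithinAt.fun_sum fun l _ => ?_
  have h1 := hasPD_comp (hf.pd l) hY hmaps k hx
  have h2 := ((hY l).pd j).hasPD k hx
  simpa [HasPD] using HasDerivWithinAt.fun_mul h1 h2

end PartialDerivatives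

section Norms

variable {d : ℕ} {f : (Fin d → ℝ) → ℝ}

theorem abs_le_supCube (hf : ContinuousOn f (cube d)) {x : Fin d → ℝ} (hx : x ∈ cube d) :
    |f x| ≤ supCube d f := by
  have hbdd := (isCompact_cube d).bddAbove_image hf.abs
  rw [Set.image_eq_range] at hbdd
  exact le_ciSup hbdd ⟨x, hx⟩

theorem finite_multiIndex (d m : ℕ) : {α : Fin d → ℕ | ∑ i, α i ≤ m}.Finite :=
  (Set.finite_Icc (0 : Fin d → ℕ) fun _ => m).subset fun _ hα =>
    ⟨fun _ => Nat.zero_le _, fun i =>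
      (Finset.single_le_sum (fun _ _ => Nat.zero_le _) (Finset.mem_univ i)).trans hα⟩

theorem supCube_mderiv_le_CmNorm {m : ℕ} (α : Fin d → ℕ) (hα : ∑ i, α i ≤ m) :
    supCube d (mderiv d α f) ≤ CmNorm d m f := by
  have : Finite {α : Fin d → ℕ // ∑ i, α i ≤ m} := finite_multiIndex d m
  exact le_ciSup (f := fun α : {α : Fin d → ℕ // ∑ i, α i ≤ m} => supCube d (mderiv d α.1 f))
    (Set.finite_range _).bddAbove ⟨α, hα⟩

theorem sum_supCube_mderiv_le_lamNorm {m : ℕ} {b : Fin d → (Fin d → ℝ) → ℝ} (α : Fin d → ℕ)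
    (h0 : 0 < ∑ i, α i) (hα : ∑ i, α i ≤ m) :
    ∑ i, supCube d (mderiv d α (b i)) ≤ lamNorm d m b := by
  have : Finite {α : Fin d → ℕ // 0 < (∑ i, α i) ∧ (∑ i, α i) ≤ m} :=
    (finite_multiIndex d m).subset fun _ h => h.2
  exact le_ciSup (f := fun α : {α : Fin d → ℕ // 0 < (∑ i, α i) ∧ (∑ i, α i) ≤ m} =>
    ∑ i, supCube d (mderiv d α.1 (b i))) (Set.finite_range _).bddAbove ⟨α, h0, hα⟩

theorem supCube_nonneg (f : (Fin d → ℝ) → ℝ) : 0 ≤ supCube d f :=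
  Real.iSup_nonneg fun _ => abs_nonneg _

theorem CmNorm_nonneg (m : ℕ) (f : (Fin d → ℝ) → ℝ) : 0 ≤ CmNorm d m f :=
  Real.iSup_nonneg fun _ => supCube_nonneg _

theorem lamNorm_nonneg (m : ℕ) (b : Fin d → (Fin d → ℝ) → ℝ) : 0 ≤ lamNorm d m b :=
  Real.iSup_nonneg fun _ => Finset.sum_nonneg fun _ _ => supCube_nonneg _

theorem foldr_pd_of_eq_zero {α : Fin d → ℕ} {l : List (Fin d)} (h : ∀ i ∈ l, α i = 0) :
    l.foldr (fun i g => (pd d i)^[α i] g) f = f := by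
  induction l with
  | nil => rfl
  | cons a l ih =>
    rw [List.foldr_cons, ih fun i hi => h i (List.mem_cons_of_mem _ hi), h a List.mem_cons_self]
    rfl

theorem foldr_pd_single {j : Fin d} {α : Fin d → ℕ} {l : List (Fin d)} (hl : l.Nodup)
    (hj : j ∈ l) (hαj : α j = 1) (h : ∀ i ∈ l, i ≠ j → α i = 0) :
    l.foldr (fun i g => (pd d i)^[α i] g) f = pd d j f := by
  induction l with
  | nil => simp at hj
  | cons a l ih =>
    rw [List.nodup_cons] at hl
    rw [List.foldr_cons]
    by_cases ha : a = j
    · subst ha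
      rw [foldr_pd_of_eq_zero fun i hi =>
        h i (List.mem_cons_of_mem _ hi) fun hia => hl.1 (hia ▸ hi), hαj]
      rfl
    · rw [ih hl.2 ((List.mem_cons.1 hj).resolve_left (Ne.symm ha))
        fun i hi => h i (List.mem_cons_of_mem _ hi), h a List.mem_cons_self ha]
      rfl

theorem foldr_pd_pair {j k : Fin d} (hjk : j ≤ k) {l : List (Fin d)} (hl : l.Pairwise (· < ·))
    (hj : j ∈ l) (hk : k ∈ l) :
    l.foldr (fun i g => (pd d i)^[(Pi.single j 1 + Pi.single k 1 : Fin d → ℕ) i] g) f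
      = pd d j (pd d k f) := by
  induction l with
  | nil => simp at hj
  | cons a l ih =>
    rw [List.pairwise_cons] at hl
    rw [List.foldr_cons]
    by_cases ha : a = j
    · subst ha
      have hal : ∀ i ∈ l, i ≠ a := fun i hi => (hl.1 i hi).ne'
      rcases hjk.eq_or_lt with rfl | hlt
      · rw [foldr_pd_of_eq_zero fun i hi => by simp [hal i hi]]
        simp
      · rw [foldr_pd_single (j := k) hl.2.nodup
          ((List.mem_cons.1 hk).resolve_left hlt.ne') (by simp [hlt.ne'])
          fun i hi hik => by simp [hik, hal i hi]]
        simp [hlt.ne]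
    · have hjl := (List.mem_cons.1 hj).resolve_left (Ne.symm ha)
      have hak : a ≠ k := ((hl.1 j hjl).trans_le hjk).ne
      rw [ih hl.2 hjl ((List.mem_cons.1 hk).resolve_left (Ne.symm hak))]
      simp [ha, hak]

theorem mderiv_single (j : Fin d) : mderiv d (Pi.single j 1) f = pd d j f :=
  foldr_pd_single (List.nodup_finRange d) (List.mem_finRange j) (by simp)
    fun i _ hi => by simp [hi]

theorem mderiv_single_add_single {j k : Fin d} (hjk : j ≤ k) :
    mderiv d (Pi.single j 1 + Pi.single k 1) f = pd d j (pd d k f) :=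
  foldr_pd_pair hjk (List.pairwise_lt_finRange d) (List.mem_finRange j) (List.mem_finRange k)

theorem exists_foldr_pd_eq (α : Fin d → ℕ) (l : List (Fin d)) :
    ∃ js : List (Fin d), js.length = (l.map α).sum ∧
      l.foldr (fun i g => (pd d i)^[α i] g) f = js.foldr (pd d) f := by
  induction l with
  | nil => exact ⟨[], rfl, rfl⟩
  | cons a l ih =>
    obtain ⟨js, hlen, hjs⟩ := ih
    refine ⟨List.replicate (α a) a ++ js, by simp [hlen], ?_⟩
    rw [List.foldr_cons, hjs, List.foldr_append]
    generalize js.foldr (pd d) f = g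
    induction α a with
    | zero => rfl
    | succ n ihn => rw [Function.iterate_succ_apply', ihn, List.replicate_succ, List.foldr_cons]

theorem exists_mderiv_eq (f : (Fin d → ℝ) → ℝ) (α : Fin d → ℕ) :
    ∃ js : List (Fin d), js.length = ∑ i, α i ∧ mderiv d α f = js.foldr (pd d) f := by
  obtain ⟨js, hlen, hjs⟩ := exists_foldr_pd_eq (f := f) α (List.finRange d)
  exact ⟨js, by rw [hlen, ← List.ofFn_eq_map, List.sum_ofFn], hjs⟩

theorem CmNorm_two_le {C : ℝ} (h0 : ∀ x ∈ cube d, |f x| ≤ C)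
    (h1 : ∀ j, ∀ x ∈ cube d, |pd d j f x| ≤ C)
    (h2 : ∀ j k, ∀ x ∈ cube d, |pd d k (pd d j f) x| ≤ C) : CmNorm d 2 f ≤ C := by
  obtain ⟨x₀, hx₀⟩ := cube_nonempty d
  have hC : 0 ≤ C := (abs_nonneg _).trans (h0 x₀ hx₀)
  refine Real.iSup_le (fun α => Real.iSup_le (fun x => ?_) hC) hC
  obtain ⟨js, hlen, hjs⟩ := exists_mderiv_eq f α.1
  have hα := α.2
  rw [← hlen] at hα
  rw [hjs]
  match js, hα with
  | [], _ => exact h0 x x.2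
  | [j], _ => exact h1 j x x.2
  | [k, j], _ => exact h2 j k x x.2
  | _ :: _ :: _ :: _, hα => simp at hα

theorem abs_le_CmNorm (hf : MemCm d 2 f) {x : Fin d → ℝ} (hx : x ∈ cube d) :
    |f x| ≤ CmNorm d 2 f := by
  have h := supCube_mderiv_le_CmNorm (f := f) (m := 2) 0 (by simp)
  rw [mderiv, foldr_pd_of_eq_zero (α := 0) fun _ _ => rfl] at h
  exact (abs_le_supCube hf.continuousOn hx).trans h

theorem abs_pd_le_CmNorm (hf : MemCm d 2 f) (j : Fin d) {x : Fin d → ℝ} (hx : x ∈ cube d) :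
    |pd d j f x| ≤ CmNorm d 2 f := by
  have h := supCube_mderiv_le_CmNorm (f := f) (m := 2) (Pi.single j 1) (by simp)
  rw [mderiv_single] at h
  exact (abs_le_supCube (hf.pd j).continuousOn hx).trans h

theorem abs_pd_pd_le_CmNorm (hf : MemCm d 2 f) (j k : Fin d) {x : Fin d → ℝ}
    (hx : x ∈ cube d) : |pd d k (pd d j f) x| ≤ CmNorm d 2 f := by
  wlog hkj : k ≤ j generalizing j k
  · rw [hf.pd_comm k j hx]
    exact this k j (le_of_not_ge hkj)
  have h := supCube_mderiv_le_CmNorm (f := f) (m := 2) (Pi.single k 1 + Pi.single j 1)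
    (by simp [Finset.sum_add_distrib])
  rw [mderiv_single_add_single hkj] at h
  exact (abs_le_supCube ((hf.pd j).pd k).continuousOn hx).trans h

variable {b : Fin d → (Fin d → ℝ) → ℝ}

theorem sum_abs_pd_le_lamNorm (hb : ∀ i, MemCm d 2 (b i)) (j : Fin d) {x : Fin d → ℝ}
    (hx : x ∈ cube d) : ∑ i, |pd d j (b i) x| ≤ lamNorm d 2 b := by
  have h := sum_supCube_mderiv_le_lamNorm (b := b) (m := 2) (Pi.single j 1) (by simp) (by simp)
  simp only [mderiv_single] at h
  exact (Finset.sum_le_sum fun i _ => abs_le_supCube ((hb i).pd j).continuousOn hx).trans h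

theorem sum_abs_pd_pd_le_lamNorm (hb : ∀ i, MemCm d 2 (b i)) (j k : Fin d) {x : Fin d → ℝ}
    (hx : x ∈ cube d) : ∑ i, |pd d k (pd d j (b i)) x| ≤ lamNorm d 2 b := by
  wlog hkj : k ≤ j generalizing j k
  · simp only [(hb _).pd_comm k j hx]
    exact this k j (le_of_not_ge hkj)
  have h := sum_supCube_mderiv_le_lamNorm (b := b) (m := 2) (Pi.single k 1 + Pi.single j 1)
    (by simp [Finset.sum_add_distrib]) (by simp [Finset.sum_add_distrib])
  simp only [mderiv_single_add_single hkj] at h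
  exact (Finset.sum_le_sum fun i _ =>
    abs_le_supCube (((hb i).pd j).pd k).continuousOn hx).trans h

end Norms

section Gronwall

theorem le_mul_exp_of_le_add_integral {φ : ℝ → ℝ} (hφ : Continuous φ) (h0 : ∀ s, 0 ≤ φ s)
    {A K T : ℝ} (hK : 0 ≤ K) (hT : 0 ≤ T)
    (h : ∀ t ∈ Set.Icc 0 T, φ t ≤ A + K * ∫ s in (0:ℝ)..t, φ s) :
    φ T ≤ A * Real.exp (K * T) := by
  have hderiv (t : ℝ) : HasDerivAt (fun t => ∫ s in (0:ℝ)..t, φ s) (φ t) t :=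
    (hφ.integral_hasStrictDerivAt 0 t).hasDerivAt
  have hnn {t : ℝ} (ht : 0 ≤ t) : 0 ≤ ∫ s in (0:ℝ)..t, φ s :=
    intervalIntegral.integral_nonneg ht fun s _ => h0 s
  have hT' : T ∈ Set.Icc 0 T := ⟨hT, le_rfl⟩
  have hg := norm_le_gronwallBound_of_norm_deriv_right_le (δ := 0) (K := K) (ε := A)
    (a := 0) (b := T) (fun t _ => (hderiv t).continuousAt.continuousWithinAt)
    (fun t _ => (hderiv t).hasDerivWithinAt) (by simp)
    (fun t ht => by
      rw [Real.norm_of_nonneg (h0 t), Real.norm_of_nonneg (hnn ht.1), add_comm]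
      exact h t ⟨ht.1, ht.2.le⟩) T hT'
  rw [Real.norm_of_nonneg (hnn hT), sub_zero] at hg
  have hφT := h T hT'
  rcases hK.eq_or_lt with rfl | hK'
  · simpa using hφT
  · rw [gronwallBound_of_K_ne_0 hK'.ne'] at hg
    calc φ T ≤ A + K * (A / K * (Real.exp (K * T) - 1)) := by
          refine hφT.trans ?_
          gcongr
          simpa using hg
      _ = A * Real.exp (K * T) := by field_simp; ring

theorem sum_abs_le_of_eq_add_integral {ι : Type*} [Fintype ι] {w g : ι → ℝ → ℝ} {w₀ : ι → ℝ}
    {K E T : ℝ} (hw : ∀ i, Continuous (w i)) (hg : ∀ i, Continuous (g i)) (hK : 0 ≤ K)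
    (hE : 0 ≤ E) (hT : 0 ≤ T)
    (h : ∀ i, ∀ t ∈ Set.Icc 0 T, w i t = w₀ i + ∫ s in (0:ℝ)..t, g i s)
    (hbd : ∀ s ∈ Set.Icc 0 T, ∑ i, |g i s| ≤ K * ∑ i, |w i s| + E) :
    ∑ i, |w i T| ≤ (∑ i, |w₀ i| + E * T) * Real.exp (K * T) := by
  have hwc : Continuous fun s => ∑ i, |w i s| := continuous_finsetSum _ fun i _ => (hw i).abs
  have hgc : Continuous fun s => ∑ i, |g i s| := continuous_finsetSum _ fun i _ => (hg i).abs
  refine le_mul_exp_of_le_add_integral hwc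
    (fun s => Finset.sum_nonneg fun _ _ => abs_nonneg _) hK hT fun t ht => ?_
  calc ∑ i, |w i t| ≤ ∑ i, (|w₀ i| + ∫ s in (0:ℝ)..t, |g i s|) := by
        gcongr with i
        rw [h i t ht]
        exact (abs_add_le _ _).trans
          (by gcongr; exact intervalIntegral.abs_integral_le_integral_abs ht.1)
    _ = ∑ i, |w₀ i| + ∫ s in (0:ℝ)..t, ∑ i, |g i s| := by
        rw [Finset.sum_add_distrib, intervalIntegral.integral_finsetSum
          fun i _ => (hg i).abs.intervalIntegrable _ _]
    _ ≤ ∑ i, |w₀ i| + ∫ s in (0:ℝ)..t, (K * ∑ i, |w i s| + E) := by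
        gcongr
        exact intervalIntegral.integral_mono_on ht.1 (hgc.intervalIntegrable _ _)
          (((hwc.const_mul K).add continuous_const).intervalIntegrable _ _)
          fun s hs => hbd s ⟨hs.1, hs.2.trans ht.2⟩
    _ = ∑ i, |w₀ i| + E * t + K * ∫ s in (0:ℝ)..t, ∑ i, |w i s| := by
        rw [intervalIntegral.integral_add ((hwc.const_mul K).intervalIntegrable _ _)
          intervalIntegrable_const, intervalIntegral.integral_const_mul]
        simp
        ring
    _ ≤ _ := by
        gcongr
        exact ht.2

theorem sum_abs_sum_mul_le {ι κ : Type*} [Fintype ι] [Fintype κ] {a : ι → κ → ℝ} {K : ℝ}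
    (h : ∀ l, ∑ i, |a i l| ≤ K) (u : κ → ℝ) :
    ∑ i, |∑ l, a i l * u l| ≤ K * ∑ l, |u l| := by
  calc ∑ i, |∑ l, a i l * u l| ≤ ∑ i, ∑ l, |a i l| * |u l| := by
        gcongr with i
        simpa only [abs_mul] using Finset.abs_sum_le_sum_abs (fun l => a i l * u l) Finset.univ
    _ = ∑ l, (∑ i, |a i l|) * |u l| := by
        rw [Finset.sum_comm]
        simp only [Finset.sum_mul]
    _ ≤ K * ∑ l, |u l| := by
        rw [Finset.mul_sum]
        gcongr with l
        exact h l

theorem sum_abs_second_order_le {ι κ : Type*} [Fintype ι] [Fintype κ] {a : ι → κ → κ → ℝ}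
    {c : ι → κ → ℝ} {K : ℝ} (ha : ∀ l m, ∑ i, |a i l m| ≤ K) (hc : ∀ l, ∑ i, |c i l| ≤ K)
    (p q r : κ → ℝ) :
    ∑ i, |∑ l, ((∑ m, a i l m * p m) * q l + c i l * r l)|
      ≤ K * ∑ l, |r l| + K * (∑ m, |p m|) * ∑ l, |q l| := by
  calc _ ≤ ∑ i, (|∑ l, c i l * r l| + |∑ l, (∑ m, a i l m * p m) * q l|) := by
        gcongr with i
        rw [Finset.sum_add_distrib, add_comm]
        exact abs_add_le _ _
    _ ≤ _ := by
        rw [Finset.sum_add_distrib]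
        exact add_le_add (sum_abs_sum_mul_le hc r)
          (sum_abs_sum_mul_le (fun l => sum_abs_sum_mul_le (ha l) p) q)

end Gronwall

section ParametricIntegral

variable {d : ℕ} {T : ℝ}

/-- Functions of time and space, continuous in time on the cube and bounded on `[0,T] × cube`. -/
def ContBdd (d : ℕ) (T : ℝ) (F : ℝ → (Fin d → ℝ) → ℝ) : Prop :=
  (∀ z ∈ cube d, Continuous fun s => F s z) ∧
    ∃ C, ∀ s ∈ Set.Icc 0 T, ∀ z ∈ cube d, |F s z| ≤ C

theorem ContBdd.add {F G : ℝ → (Fin d → ℝ) → ℝ} (hF : ContBdd d T F) (hG : ContBdd d T G) :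
    ContBdd d T fun s z => F s z + G s z := by
  obtain ⟨hFc, C, hC⟩ := hF
  obtain ⟨hGc, D, hD⟩ := hG
  exact ⟨fun z hz => (hFc z hz).add (hGc z hz), C + D, fun s hs z hz =>
    (abs_add_le _ _).trans (add_le_add (hC s hs z hz) (hD s hs z hz))⟩

theorem ContBdd.mul {F G : ℝ → (Fin d → ℝ) → ℝ} (hF : ContBdd d T F) (hG : ContBdd d T G) :
    ContBdd d T fun s z => F s z * G s z := by
  obtain ⟨hFc, C, hC⟩ := hF
  obtain ⟨hGc, D, hD⟩ := hG
  refine ⟨fun z hz => (hFc z hz).mul (hGc z hz), C * D, fun s hs z hz => ?_⟩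
  rw [abs_mul]
  exact mul_le_mul (hC s hs z hz) (hD s hs z hz) (abs_nonneg _)
    ((abs_nonneg _).trans (hC s hs z hz))

theorem ContBdd.sum {ι : Type*} [Fintype ι] {F : ι → ℝ → (Fin d → ℝ) → ℝ}
    (hF : ∀ i, ContBdd d T (F i)) : ContBdd d T fun s z => ∑ i, F i s z := by
  choose hc C hC using hF
  exact ⟨fun z hz => continuous_finsetSum _ fun i _ => hc i z hz, ∑ i, C i, fun s hs z hz =>
    (Finset.abs_sum_le_sum_abs _ _).trans (Finset.sum_le_sum fun i _ => hC i s hs z hz)⟩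

theorem ContBdd.of_continuousOn {F : ℝ → (Fin d → ℝ) → ℝ}
    (hF : ContinuousOn (fun q : ℝ × (Fin d → ℝ) => F q.1 q.2) (Set.univ ×ˢ cube d)) :
    ContBdd d T F := by
  refine ⟨fun z hz => hF.comp_continuous (f := fun s => (s, z)) (by fun_prop)
    fun s => ⟨trivial, hz⟩, ?_⟩
  obtain ⟨C, hC⟩ := (isCompact_Icc.prod (isCompact_cube d)).exists_bound_of_continuousOn
    (hF.mono (Set.prod_mono (Set.subset_univ (Set.Icc 0 T)) subset_rfl))
  exact ⟨C, fun s hs z hz => hC (s, z) ⟨hs, hz⟩⟩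

theorem hasPD_integral {F F' : ℝ → (Fin d → ℝ) → ℝ} (hT : 0 ≤ T) {j : Fin d} {x : Fin d → ℝ}
    (hx : x ∈ cube d) (hxj : x j ∈ Set.Ioo (0:ℝ) 1)
    (hF : ∀ z ∈ cube d, Continuous fun s => F s z) (hF' : ContBdd d T F')
    (hpd : ∀ s ∈ Set.Icc 0 T, ∀ z ∈ cube d, HasPD d j (F s) (F' s z) z) :
    HasPD d j (fun z => ∫ s in (0:ℝ)..T, F s z) (∫ s in (0:ℝ)..T, F' s x) x := by
  obtain ⟨hF'c, C, hC⟩ := hF'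
  have hmem {τ : ℝ} (hτ : τ ∈ Set.Ioo (0:ℝ) 1) : Function.update x j τ ∈ cube d :=
    update_mem_cube hx j (Set.Ioo_subset_Icc_self hτ)
  have hnhds : Set.Ioo (0:ℝ) 1 ∈ nhds (x j) := isOpen_Ioo.mem_nhds hxj
  have hIoc {s : ℝ} (hs : s ∈ Set.uIoc 0 T) : s ∈ Set.Icc 0 T := by
    rw [Set.uIoc_of_le hT] at hs
    exact Set.Ioc_subset_Icc_self hs
  have h := (intervalIntegral.hasDerivAt_integral_of_dominated_loc_of_deriv_le
    (μ := volume) (a := 0) (b := T) (bound := fun _ => C)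
    (F := fun τ s => F s (Function.update x j τ))
    (F' := fun τ s => F' s (Function.update x j τ)) hnhds
    (by
      filter_upwards [hnhds] with τ hτ
      exact (hF _ (hmem hτ)).aestronglyMeasurable)
    ((hF _ (hmem hxj)).intervalIntegrable _ _)
    (hF'c _ (hmem hxj)).aestronglyMeasurable
    (ae_of_all _ fun s hs τ hτ => hC s (hIoc hs) _ (hmem hτ))
    intervalIntegrable_const
    (ae_of_all _ fun s hs τ hτ => by
      have := hpd s (hIoc hs) _ (hmem hτ)
      simp only [HasPD, Function.update_idem, Function.update_self] at this
      exact this.hasDerivAt (Icc_mem_nhds hτ.1 hτ.2))).2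
  simp only [Function.update_eq_self] at h
  exact h.hasDerivWithinAt

end ParametricIntegral

section Flow

variable {d : ℕ} {b : Fin d → (Fin d → ℝ) → ℝ} {Y : ℝ → (Fin d → ℝ) → Fin d → ℝ}

/-- A flow of `b` on the cube, twice continuously differentiable in space, extended to negative
times by its value at time `0`. -/
structure IsC2Flow (d : ℕ) (b : Fin d → (Fin d → ℝ) → ℝ) (Y : ℝ → (Fin d → ℝ) → Fin d → ℝ) :
    Prop where
  mapsTo : ∀ t, Set.MapsTo (Y t) (cube d) (cube d)
  eq_add_integral : ∀ i, ∀ t, 0 ≤ t → ∀ x ∈ cube d, Y t x i = x i + ∫ s in (0:ℝ)..t, b i (Y s x)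
  eq_zero : ∀ t, t ≤ 0 → Y t = Y 0
  memCm : ∀ t i, MemCm d 2 fun x => Y t x i
  continuousOn_pd : ∀ i j, ContinuousOn
    (fun q : ℝ × (Fin d → ℝ) => pd d j (fun x => Y q.1 x i) q.2) (Set.univ ×ˢ cube d)
  continuousOn_pd_pd : ∀ i j k, ContinuousOn
    (fun q : ℝ × (Fin d → ℝ) => pd d k (pd d j fun x => Y q.1 x i) q.2) (Set.univ ×ˢ cube d)

namespace IsC2Flow

theorem measurable (h : IsC2Flow d b Y) (hb : ∀ i, ContinuousOn (b i) (cube d))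
    {x : Fin d → ℝ} (hx : x ∈ cube d) (i : Fin d) : Measurable fun t => Y t x i := by
  classical
  set A : Set ℝ := {t | 0 ≤ t ∧ IntervalIntegrable (fun s => b i (Y s x)) volume 0 t} with hA
  have hsubint {s t : ℝ} (hs : s ∈ A) (ht : t ∈ A) :
      (∫ r in (0:ℝ)..t, b i (Y r x)) - ∫ r in (0:ℝ)..s, b i (Y r x)
        = ∫ r in s..t, b i (Y r x) :=
    intervalIntegral.integral_interval_sub_left ht.2 hs.2
  have hAmeas : MeasurableSet A := by
    refine Set.OrdConnected.measurableSet ⟨fun s hs t ht r hr => ⟨hs.1.trans hr.1, ?_⟩⟩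
    refine ht.2.mono_set ?_
    rw [Set.uIcc_of_le (hs.1.trans hr.1), Set.uIcc_of_le ht.1]
    exact Set.Icc_subset_Icc_right hr.2
  have hlip : LipschitzOnWith (supCube d (b i)).toNNReal
      (fun t => x i + ∫ s in (0:ℝ)..t, b i (Y s x)) A := by
    refine LipschitzOnWith.of_dist_le_mul fun t ht s hs => ?_
    rw [dist_add_left, Real.dist_eq, hsubint hs ht, Real.coe_toNNReal _ (supCube_nonneg _),
      Real.dist_eq]
    exact intervalIntegral.norm_integral_le_of_norm_le_const (C := supCube d (b i))
      (f := fun r => b i (Y r x)) fun r _ => abs_le_supCube (hb i) (h.mapsTo r hx)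
  have hpw : (fun t => Y t x i)
      = A.piecewise (fun t => x i + ∫ s in (0:ℝ)..t, b i (Y s x)) fun _ => x i := by
    funext t
    by_cases ht : t ∈ A
    · rw [Set.piecewise_eq_of_mem _ _ _ ht]
      exact h.eq_add_integral i t ht.1 x hx
    · rw [Set.piecewise_eq_of_notMem _ _ _ ht]
      rcases le_total 0 t with h0 | h0
      · rw [h.eq_add_integral i t h0 x hx, intervalIntegral.integral_undef fun hi => ht ⟨h0, hi⟩,
          add_zero]
      · rw [h.eq_zero t h0, h.eq_add_integral i 0 le_rfl x hx]
        simp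
  rw [hpw]
  exact hlip.continuousOn.measurable_piecewise continuousOn_const hAmeas

theorem continuous (h : IsC2Flow d b Y) (hb : ∀ i, ContinuousOn (b i) (cube d))
    {x : Fin d → ℝ} (hx : x ∈ cube d) : Continuous fun t => Y t x := by
  have hmeas (i : Fin d) : Measurable fun s => b i (Y s x) := by
    have h1 : Measurable fun s => (⟨Y s x, h.mapsTo s hx⟩ : cube d) :=
      (measurable_pi_lambda _ fun i => h.measurable hb hx i).subtype_mk
    exact (continuousOn_iff_continuous_domRestrict.1 (hb i)).measurable.comp h1
  have hint (i : Fin d) (s t : ℝ) : IntervalIntegrable (fun s => b i (Y s x)) volume s t :=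
    (intervalIntegrable_const (c := supCube d (b i))).mono_fun'
      (hmeas i).aestronglyMeasurable
      (ae_of_all _ fun r => abs_le_supCube (hb i) (h.mapsTo r hx))
  refine continuous_pi fun i => ?_
  have heq : (fun t => Y t x i) = fun t => x i + ∫ s in (0:ℝ)..(max t 0), b i (Y s x) := by
    funext t
    rw [← h.eq_add_integral i _ (le_max_right t 0) x hx]
    rcases le_total 0 t with h0 | h0
    · rw [max_eq_left h0]
    · rw [max_eq_right h0, h.eq_zero t h0]
  rw [heq]
  exact continuous_const.add
    ((intervalIntegral.continuous_primitive (hint i) 0).comp (continuous_id.max continuous_const))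

theorem contBdd_comp (h : IsC2Flow d b Y) (hb : ∀ i, ContinuousOn (b i) (cube d)) (T : ℝ)
    {g : (Fin d → ℝ) → ℝ} (hg : ContinuousOn g (cube d)) : ContBdd d T fun s z => g (Y s z) :=
  ⟨fun _ hz => hg.comp_continuous (h.continuous hb hz) fun s => h.mapsTo s hz,
    supCube d g, fun s _ _ hz => abs_le_supCube hg (h.mapsTo s hz)⟩

theorem contBdd_pd (h : IsC2Flow d b Y) (T : ℝ) (i j : Fin d) :
    ContBdd d T fun s => pd d j fun x => Y s x i :=
  ContBdd.of_continuousOn (h.continuousOn_pd i j)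

theorem contBdd_pd_pd (h : IsC2Flow d b Y) (T : ℝ) (i j k : Fin d) :
    ContBdd d T fun s => pd d k (pd d j fun x => Y s x i) :=
  ContBdd.of_continuousOn (h.continuousOn_pd_pd i j k)

theorem contBdd_firstVariation (h : IsC2Flow d b Y) (hb : ∀ i, MemCm d 2 (b i)) (T : ℝ)
    (i j : Fin d) :
    ContBdd d T fun s x => ∑ l, pd d l (b i) (Y s x) * pd d j (fun x => Y s x l) x :=
  ContBdd.sum fun l =>
    (h.contBdd_comp (fun i => (hb i).continuousOn) T ((hb i).pd l).continuousOn).mul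
      (h.contBdd_pd T l j)

theorem contBdd_secondVariation (h : IsC2Flow d b Y) (hb : ∀ i, MemCm d 2 (b i)) (T : ℝ)
    (i j k : Fin d) :
    ContBdd d T fun s x =>
      ∑ l, ((∑ m, pd d m (pd d l (b i)) (Y s x) * pd d k (fun x => Y s x m) x)
          * pd d j (fun x => Y s x l) x
        + pd d l (b i) (Y s x) * pd d k (pd d j (fun x => Y s x l)) x) := by
  have hb0 (i : Fin d) := (hb i).continuousOn
  exact ContBdd.sum fun l => ((ContBdd.sum fun m =>
    (h.contBdd_comp hb0 T (((hb i).pd l).pd m).continuousOn).mul (h.contBdd_pd T m k)).mul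
      (h.contBdd_pd T l j)).add
    ((h.contBdd_comp hb0 T ((hb i).pd l).continuousOn).mul (h.contBdd_pd_pd T l j k))

theorem pd_eq_add_integral (h : IsC2Flow d b Y) (hb : ∀ i, MemCm d 2 (b i)) {t : ℝ} (ht : 0 ≤ t)
    (i j : Fin d) {x : Fin d → ℝ} (hx : x ∈ cube d) (hxj : x j ∈ Set.Ioo (0:ℝ) 1) :
    pd d j (fun x => Y t x i) x = (Pi.single j 1 : Fin d → ℝ) i
      + ∫ s in (0:ℝ)..t, ∑ l, pd d l (b i) (Y s x) * pd d j (fun x => Y s x l) x := by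
  have hint := hasPD_integral ht hx hxj
    (h.contBdd_comp (fun i => (hb i).continuousOn) t (hb i).continuousOn).1
    (h.contBdd_firstVariation hb t i j)
    fun s _ z hz => hasPD_comp (hb i) (h.memCm s) (h.mapsTo s) j hz
  have hid : HasPD d j (fun x => x i) ((Pi.single j 1 : Fin d → ℝ) i) x :=
    (hasDerivAt_pi.1 (hasDerivAt_update x j (x j)) i).hasDerivWithinAt
  have hsum : HasPD d j (fun x => x i + ∫ s in (0:ℝ)..t, b i (Y s x)) _ x :=
    HasDerivWithinAt.add hid hint
  exact (hsum.congr hx fun z hz => h.eq_add_integral i t ht z hz).pd_eq hx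

theorem pd_pd_eq_integral (h : IsC2Flow d b Y) (hb : ∀ i, MemCm d 2 (b i)) {t : ℝ} (ht : 0 ≤ t)
    (i j k : Fin d) {x : Fin d → ℝ} (hx : ∀ j, x j ∈ Set.Ioo (0:ℝ) 1) :
    pd d k (pd d j fun x => Y t x i) x = ∫ s in (0:ℝ)..t,
      ∑ l, ((∑ m, pd d m (pd d l (b i)) (Y s x) * pd d k (fun x => Y s x m) x)
          * pd d j (fun x => Y s x l) x
        + pd d l (b i) (Y s x) * pd d k (pd d j (fun x => Y s x l)) x) := by
  have hxc : x ∈ cube d := fun j _ => Set.Ioo_subset_Icc_self (hx j)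
  have hint := hasPD_integral ht hxc (hx k) (h.contBdd_firstVariation hb t i j).1
    (h.contBdd_secondVariation hb t i j k)
    fun s _ z hz => hasPD_chain (hb i) (h.memCm s) (h.mapsTo s) j k hz
  refine HasPD.pd_eq ?_ hxc
  refine HasDerivWithinAt.congr_of_eventuallyEq
    (HasDerivWithinAt.const_add ((Pi.single j 1 : Fin d → ℝ) i) hint) ?_ ?_
  · filter_upwards [mem_nhdsWithin_of_mem_nhds (isOpen_Ioo.mem_nhds (hx k))] with τ hτ
    refine h.pd_eq_add_integral hb ht i j
      (update_mem_cube hxc k (Set.Ioo_subset_Icc_self hτ)) ?_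
    by_cases hjk : j = k
    · subst hjk; simpa using hτ
    · simpa [hjk] using hx j
  · rw [Function.update_eq_self]
    exact h.pd_eq_add_integral hb ht i j hxc (hx j)

theorem sum_abs_pd_le (h : IsC2Flow d b Y) (hb : ∀ i, MemCm d 2 (b i)) {t : ℝ} (ht : 0 ≤ t)
    (j : Fin d) {x : Fin d → ℝ} (hx : x ∈ cube d) :
    ∑ i, |pd d j (fun x => Y t x i) x| ≤ Real.exp (lamNorm d 2 b * t) := by
  rw [← closure_pi_Ioo] at hx
  refine le_on_closure (s := Set.univ.pi fun _ : Fin d => Set.Ioo (0:ℝ) 1)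
    (f := fun x => ∑ i, |pd d j (fun x => Y t x i) x|)
    (g := fun _ => Real.exp (lamNorm d 2 b * t)) (fun z hz => ?_) ?_ continuousOn_const hx
  · have hzc : z ∈ cube d := fun j _ => Set.Ioo_subset_Icc_self (hz j trivial)
    have := sum_abs_le_of_eq_add_integral (K := lamNorm d 2 b) (E := 0)
      (w := fun i s => pd d j (fun x => Y s x i) z)
      (fun i => (h.contBdd_pd t i j).1 z hzc)
      (fun i => (h.contBdd_firstVariation hb t i j).1 z hzc)
      (lamNorm_nonneg 2 b) le_rfl ht
      (fun i s hs => h.pd_eq_add_integral hb hs.1 i j hzc (hz j trivial))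
      fun s _ => by
        rw [add_zero]
        exact sum_abs_sum_mul_le (fun l => sum_abs_pd_le_lamNorm hb l (h.mapsTo s hzc)) _
    simpa [Pi.single_apply, apply_ite abs] using this
  · rw [closure_pi_Ioo]
    exact continuousOn_finsetSum _ fun i _ => ((h.memCm t i).pd j).continuousOn.abs

theorem sum_abs_pd_pd_le (h : IsC2Flow d b Y) (hb : ∀ i, MemCm d 2 (b i)) {t : ℝ} (ht : 0 ≤ t)
    (j k : Fin d) {x : Fin d → ℝ} (hx : x ∈ cube d) :
    ∑ i, |pd d k (pd d j fun x => Y t x i) x|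
      ≤ lamNorm d 2 b * t * Real.exp (lamNorm d 2 b * t) ^ 3 := by
  rw [← closure_pi_Ioo] at hx
  refine le_on_closure (s := Set.univ.pi fun _ : Fin d => Set.Ioo (0:ℝ) 1)
    (f := fun x => ∑ i, |pd d k (pd d j fun x => Y t x i) x|)
    (g := fun _ => lamNorm d 2 b * t * Real.exp (lamNorm d 2 b * t) ^ 3)
    (fun z hz => ?_) ?_ continuousOn_const hx
  · have hzc : z ∈ cube d := fun j _ => Set.Ioo_subset_Icc_self (hz j trivial)
    have hlam := lamNorm_nonneg 2 b
    have hexp (j : Fin d) {s : ℝ} (hs : s ∈ Set.Icc 0 t) :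
        ∑ i, |pd d j (fun x => Y s x i) z| ≤ Real.exp (lamNorm d 2 b * t) :=
      (h.sum_abs_pd_le hb hs.1 j hzc).trans (by gcongr; exact hs.2)
    have := sum_abs_le_of_eq_add_integral (K := lamNorm d 2 b)
      (E := lamNorm d 2 b * Real.exp (lamNorm d 2 b * t) * Real.exp (lamNorm d 2 b * t))
      (w := fun i s => pd d k (pd d j fun x => Y s x i) z) (w₀ := fun _ => 0)
      (fun i => (h.contBdd_pd_pd t i j k).1 z hzc)
      (fun i => (h.contBdd_secondVariation hb t i j k).1 z hzc)
      hlam (by positivity) ht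
      (fun i s hs => by
        rw [zero_add]
        exact h.pd_pd_eq_integral hb hs.1 i j k fun j => hz j trivial)
      fun s hs => by
        refine (sum_abs_second_order_le
          (fun l m => sum_abs_pd_pd_le_lamNorm hb l m (h.mapsTo s hzc))
          (fun l => sum_abs_pd_le_lamNorm hb l (h.mapsTo s hzc)) _ _ _).trans ?_
        gcongr
        · exact hexp k hs
        · exact hexp j hs
    refine this.trans_eq ?_
    simp
    ring
  · rw [closure_pi_Ioo]
    exact continuousOn_finsetSum _ fun i _ => (((h.memCm t i).pd j).pd k).continuousOn.abs

theorem CmNorm_comp_le (h : IsC2Flow d b Y) (hb : ∀ i, MemCm d 2 (b i)) {t : ℝ} (ht : 0 ≤ t)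
    {f : (Fin d → ℝ) → ℝ} (hf : MemCm d 2 f) :
    CmNorm d 2 (fun x => f (Y t x)) ≤ Real.exp (4 * lamNorm d 2 b * t) * CmNorm d 2 f := by
  set N := CmNorm d 2 f
  set L := lamNorm d 2 b * t with hL
  set a := Real.exp L with ha
  have hN : 0 ≤ N := CmNorm_nonneg 2 f
  have hL0 : 0 ≤ L := mul_nonneg (lamNorm_nonneg 2 b) ht
  have ha1 : L + 1 ≤ a := Real.add_one_le_exp L
  have ha4 : Real.exp (4 * lamNorm d 2 b * t) = a ^ 4 := by
    rw [ha, ← Real.exp_nat_mul, hL]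
    congr 1
    push_cast
    ring
  have ha1' : 1 ≤ a := by linarith
  have hmono : a ≤ a ^ 4 := le_self_pow₀ ha1' (by norm_num)
  have hpoly : L * a ^ 3 + a * a ≤ a ^ 4 := by
    have : 0 ≤ a ^ 2 * ((a - 1 - L) * a + (a - 1)) := by
      have h1 : 0 ≤ a - 1 - L := by linarith
      have h2 : 0 ≤ a - 1 := by linarith
      positivity
    nlinarith
  have hpd {x : Fin d → ℝ} (hx : x ∈ cube d) (l : Fin d) : |pd d l f (Y t x)| ≤ N :=
    abs_pd_le_CmNorm hf l (h.mapsTo t hx)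
  have hcomp (j : Fin d) {x : Fin d → ℝ} (hx : x ∈ cube d) :
      pd d j (fun x => f (Y t x)) x = ∑ l, pd d l f (Y t x) * pd d j (fun x => Y t x l) x :=
    (hasPD_comp hf (h.memCm t) (h.mapsTo t) j hx).pd_eq hx
  rw [ha4, mul_comm]
  refine CmNorm_two_le (fun x hx => ?_) (fun j x hx => ?_) fun j k x hx => ?_
  · exact (abs_le_CmNorm hf (h.mapsTo t hx)).trans
      (le_mul_of_one_le_right hN (ha1'.trans hmono))
  · rw [hcomp j hx]
    have := sum_abs_sum_mul_le (ι := Unit) (a := fun _ l => pd d l f (Y t x)) (K := N)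
      (fun l => by simpa using hpd hx l) fun l => pd d j (fun x => Y t x l) x
    rw [Fintype.sum_unique] at this
    refine this.trans ?_
    gcongr
    exact (h.sum_abs_pd_le hb ht j hx).trans hmono
  · rw [pd_congr k (fun z hz => hcomp j hz) hx,
      (hasPD_chain hf (h.memCm t) (h.mapsTo t) j k hx).pd_eq hx]
    have := sum_abs_second_order_le (ι := Unit) (K := N)
      (a := fun _ l m => pd d m (pd d l f) (Y t x)) (c := fun _ l => pd d l f (Y t x))
      (fun l m => by simpa using abs_pd_pd_le_CmNorm hf l m (h.mapsTo t hx))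
      (fun l => by simpa using hpd hx l)
      (fun m => pd d k (fun x => Y t x m) x) (fun l => pd d j (fun x => Y t x l) x)
      fun l => pd d k (pd d j fun x => Y t x l) x
    rw [Fintype.sum_unique] at this
    refine this.trans ?_
    calc _ ≤ N * (L * a ^ 3) + N * a * a := by
          gcongr
          · exact h.sum_abs_pd_pd_le hb ht j k hx
          · exact h.sum_abs_pd_le hb ht k hx
          · exact h.sum_abs_pd_le hb ht j hx
      _ = N * (L * a ^ 3 + a * a) := by ring
      _ ≤ N * a ^ 4 := by gcongr

end IsC2Flow

end Flow

/-- `C²`-estimate for the drift semigroup `T¹_t f = f ∘ y(t,·)`: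
if `f ∈ C²([0,1]^d,ℝ)` then `T¹_t f ∈ C²([0,1]^d,ℝ)` and
`‖T¹_t f‖_{C²} ≤ e^{4 λ₂ t} ‖f‖_{C²}`. -/
theorem drift_semigroup_C2_estimate
    (d : ℕ) (hd : 0 < d)
    (b : Fin d → (Fin d → ℝ) → ℝ)
    (hb : ∀ i : Fin d, MemCm d 3 (b i))
    (hbdry : ∀ i : Fin d, ∀ x ∈ cube d,
      (x i = 0 → 0 ≤ b i x) ∧ (x i = 1 → b i x ≤ 0))
    (y : ℝ → (Fin d → ℝ) → (Fin d → ℝ))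
    (hy_cube : ∀ t ∈ Set.Ici (0:ℝ), ∀ x ∈ cube d, y t x ∈ cube d)
    (hy_flow : ∀ i : Fin d, ∀ t ∈ Set.Ici (0:ℝ), ∀ x ∈ cube d,
      y t x i = x i + ∫ s in (0:ℝ)..t, b i (y s x))
    (hy_C2 : ∀ t ∈ Set.Ici (0:ℝ), ∀ i : Fin d, MemCm d 2 (fun x => y t x i))
    (hy_joint1 : ∀ i j : Fin d, ContinuousOn
      (fun q : ℝ × (Fin d → ℝ) => pd d j (fun x => y q.1 x i) q.2)
      (Set.Ici (0:ℝ) ×ˢ cube d))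
    (hy_joint2 : ∀ i j k : Fin d, ContinuousOn
      (fun q : ℝ × (Fin d → ℝ) => pd d k (pd d j (fun x => y q.1 x i)) q.2)
      (Set.Ici (0:ℝ) ×ˢ cube d))
    (f : (Fin d → ℝ) → ℝ) (hf : MemCm d 2 f) (t : ℝ) (ht : 0 ≤ t) :
    MemCm d 2 (fun x => f (y t x)) ∧
    CmNorm d 2 (fun x => f (y t x)) ≤ Real.exp (4 * lamNorm d 2 b * t) * CmNorm d 2 f := by
  have hflow : IsC2Flow d b fun s => y (max s 0) := by
    have hprod (g : ℝ × (Fin d → ℝ) → ℝ) (hg : ContinuousOn g (Set.Ici (0:ℝ) ×ˢ cube d)) :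
        ContinuousOn (fun q : ℝ × (Fin d → ℝ) => g (max q.1 0, q.2)) (Set.univ ×ˢ cube d) :=
      hg.comp (by fun_prop) fun q hq => ⟨le_max_right q.1 0, hq.2⟩
    refine ⟨fun s x hx => hy_cube _ (le_max_right s 0) x hx, fun i s hs x hx => ?_,
      fun s hs => by simp [hs], fun s i => hy_C2 _ (le_max_right s 0) i,
      fun i j => hprod _ (hy_joint1 i j), fun i j k => hprod _ (hy_joint2 i j k)⟩
    rw [max_eq_left hs, hy_flow i s hs x hx]
    congr 1
    refine intervalIntegral.integral_congr fun r hr => ?_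
    rw [Set.uIcc_of_le hs] at hr
    simp [hr.1]
  refine ⟨hf.comp (hy_C2 t ht) fun x hx => hy_cube t ht x hx, ?_⟩
  have := hflow.CmNorm_comp_le (fun i => (hb i).of_succ) ht hf
  simpa only [max_eq_left ht] using this

end
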